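/- arXiv:2304.04953 — 12 statements merged into one kernel-verified Lean document; each statement's English description precedes it below -/
import Mathlib

section
/- Let n ≥ 2 be an integer and let (i,i') be a minimal regularity element for n with i ≤ i'. Then Δ²H_n(i+1, i'+1) ≥ 0 if and only if either (a) i(i'+2) ≤ n, or (b) i(i'+2) > n and 3n − 3ii' − 2i − 2i' ≥ 0. -/
/-- The generic Hilbert function of `n` points in sufficiently general position
in `ℙ¹ × ℙ¹`. -/
def Hgen (n i i' : ℤ) : ℤ :=
  if 0 ≤ i ∧ 0 ≤ i' then min n ((i + 1) * (i' + 1)) else 0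

/-- The second difference function `Δ²H_n`. -/
def Delta2H (n i i' : ℤ) : ℤ :=
  ∑ a ∈ Finset.range 3, ∑ b ∈ Finset.range 3,
    (-1 : ℤ) ^ (a + b) * (Nat.choose 2 a : ℤ) * (Nat.choose 2 b : ℤ) *
      Hgen n (i - (a : ℤ)) (i' - (b : ℤ))

/-- `(i, i')` is a minimal element of the multigraded regularity of the coordinate
ring of `n` points in sufficiently general position in `ℙ¹ × ℙ¹`. -/
def MinRegElem (n i i' : ℤ) : Prop :=
  0 ≤ i ∧ 0 ≤ i' ∧ (i + 1) * (i' + 1) ≥ n ∧ i * (i' + 1) < n ∧ (i + 1) * i' < n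

lemma Hgen_eq (n i i' : ℤ) (h1 : -1 ≤ i) (h2 : -1 ≤ i') (hn : 0 ≤ n) :
    Hgen n i i' = min n ((i + 1) * (i' + 1)) := by
  unfold Hgen
  split_ifs with h
  · rfl
  · have : i = -1 ∨ i' = -1 := by omega
    rcases this with rfl | rfl <;> simp [hn]

theorem stmt_0 (n i i' : ℤ) (hn : 2 ≤ n) (h : MinRegElem n i i') (hii' : i ≤ i') :
    0 ≤ Delta2H n (i + 1) (i' + 1) ↔
      (i * (i' + 2) ≤ n ∨ (i * (i' + 2) > n ∧ 3 * n - 3 * i * i' - 2 * i - 2 * i' ≥ 0)) := by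
  obtain ⟨h0, h0', h1, h2, h3⟩ := h
  have key : Delta2H n (i + 1) (i' + 1) =
      n + min n ((i + 2) * i') + min n (i * (i' + 2)) - 3 * (i * i') - 2 * i - 2 * i' := by
    have hc : Nat.choose 2 1 = 2 := rfl
    simp only [Delta2H, Finset.sum_range_succ, Finset.sum_range_zero, Nat.choose_self,
      Nat.choose_zero_right, hc]
    push_cast
    repeat rw [Hgen_eq _ _ _ (by omega) (by omega) (by omega)]
    have e1 : min n ((i + 1 - 0 + 1) * (i' + 1 - 0 + 1)) = n := min_eq_left (by nlinarith)
    have e2 : min n ((i + 1 - 0 + 1) * (i' + 1 - 1 + 1)) = n := min_eq_left (by nlinarith)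
    have e3 : min n ((i + 1 - 1 + 1) * (i' + 1 - 0 + 1)) = n := min_eq_left (by nlinarith)
    have e4 : min n ((i + 1 - 1 + 1) * (i' + 1 - 1 + 1)) = n := min_eq_left (by nlinarith)
    have e5 : min n ((i + 1 - 1 + 1) * (i' + 1 - 2 + 1)) = (i + 1) * i' := by
      rw [min_eq_right (by nlinarith)]; ring
    have e6 : min n ((i + 1 - 2 + 1) * (i' + 1 - 1 + 1)) = i * (i' + 1) := by
      rw [min_eq_right (by nlinarith)]; ring
    have e7 : min n ((i + 1 - 2 + 1) * (i' + 1 - 2 + 1)) = i * i' := by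
      rw [min_eq_right (by nlinarith)]; ring
    have e8 : (i + 1 - 0 + 1) * (i' + 1 - 2 + 1) = (i + 2) * i' := by ring
    have e9 : (i + 1 - 2 + 1) * (i' + 1 - 0 + 1) = i * (i' + 2) := by ring
    rw [e1, e2, e3, e4, e5, e6, e7, e8, e9]
    ring
  rw [key]
  have a1 : (i + 2) * i' = i * i' + 2 * i' := by ring
  have a2 : i * (i' + 2) = i * i' + 2 * i := by ring
  have a3 : 3 * i * i' = 3 * (i * i') := by ring
  have a4 : (i + 1) * i' = i * i' + i' := by ring
  rw [a4] at h3
  rw [a1, a2, a3]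
  generalize i * i' = m at *
  omega
end

section
/- Let n ≥ 2 be an integer and let (i,i') be a minimal regularity element for n. Then Δ²H_n(i+1, i'+1) = n + ii' − 2i(i'+1) − 2(i+1)i' + min(i(i'+2), n) + min((i+2)i', n). -/
theorem Hgen_eq_s1 (n a b : ℤ) (hn : 2 ≤ n) (ha : -1 ≤ a) (hb : -1 ≤ b) :
    Hgen n a b = min n ((a + 1) * (b + 1)) := by
  unfold Hgen
  split_ifs with h
  · rfl
  · have h0 : (a + 1) * (b + 1) = 0 := by
      rcases (by omega : a = -1 ∨ b = -1) with rfl | rfl <;> simp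
    rw [h0, min_eq_right (by omega)]

theorem stmt_1 (n i i' : ℤ) (hn : 2 ≤ n) (h : MinRegElem n i i') :
    Delta2H n (i + 1) (i' + 1) =
      n + i * i' - 2 * (i * (i' + 1)) - 2 * ((i + 1) * i')
        + min (i * (i' + 2)) n + min ((i + 2) * i') n := by
  obtain ⟨hi, hi', h1, h2, h3⟩ := h
  have e00 : Hgen n (i + 1) (i' + 1) = n := by
    rw [Hgen_eq_s1 n _ _ hn (by omega) (by omega)]
    exact min_eq_left (by nlinarith)
  have e01 : Hgen n (i + 1) i' = n := by
    rw [Hgen_eq_s1 n _ _ hn (by omega) (by omega)]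
    exact min_eq_left (by nlinarith)
  have e10 : Hgen n i (i' + 1) = n := by
    rw [Hgen_eq_s1 n _ _ hn (by omega) (by omega)]
    exact min_eq_left (by nlinarith)
  have e11 : Hgen n i i' = n := by
    rw [Hgen_eq_s1 n _ _ hn (by omega) (by omega)]
    exact min_eq_left (by nlinarith)
  have e02 : Hgen n (i + 1) (i' - 1) = min ((i + 2) * i') n := by
    rw [Hgen_eq_s1 n _ _ hn (by omega) (by omega), min_comm]
    congr 1; ring
  have e20 : Hgen n (i - 1) (i' + 1) = min (i * (i' + 2)) n := by
    rw [Hgen_eq_s1 n _ _ hn (by omega) (by omega), min_comm]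
    congr 1; ring
  have e12 : Hgen n i (i' - 1) = (i + 1) * i' := by
    rw [Hgen_eq_s1 n _ _ hn (by omega) (by omega), min_eq_right (by nlinarith)]
    ring
  have e21 : Hgen n (i - 1) i' = i * (i' + 1) := by
    rw [Hgen_eq_s1 n _ _ hn (by omega) (by omega), min_eq_right (by nlinarith)]
    ring
  have e22 : Hgen n (i - 1) (i' - 1) = i * i' := by
    rw [Hgen_eq_s1 n _ _ hn (by omega) (by omega), min_eq_right (by nlinarith)]
    ring
  have s0 : ∀ x : ℤ, x + 1 - ((0 : ℕ) : ℤ) = x + 1 := fun x => by simp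
  have s1 : ∀ x : ℤ, x + 1 - ((1 : ℕ) : ℤ) = x := fun x => by simp
  have s2 : ∀ x : ℤ, x + 1 - ((2 : ℕ) : ℤ) = x - 1 := fun x => by push_cast; ring
  unfold Delta2H
  simp only [Finset.sum_range_succ, Finset.sum_range_zero, s0, s1, s2,
    e00, e01, e10, e11, e02, e20, e12, e21, e22]
  norm_num [Nat.choose]
  ring
end

section
/- Let n ≥ 2 be an integer and let (i,i') be a minimal regularity element for n. Then Δ²H_n(i, i') = n − (i+1)(i'+1), and in particular Δ²H_n(i, i') ≤ 0. -/
lemma Hgen_of_le (n a b : ℤ) (ha : -1 ≤ a) (hb : -1 ≤ b) (h : (a + 1) * (b + 1) ≤ n) :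
    Hgen n a b = (a + 1) * (b + 1) := by
  unfold Hgen
  split_ifs with hc
  · exact min_eq_right h
  · have : a = -1 ∨ b = -1 := by omega
    rcases this with rfl | rfl <;> simp

lemma Hgen_of_neg (n a b : ℤ) (h : a < 0 ∨ b < 0) : Hgen n a b = 0 := by
  unfold Hgen
  rw [if_neg (by omega)]

theorem stmt_2 (n i i' : ℤ) (hn : 2 ≤ n) (h : MinRegElem n i i') :
    Delta2H n i i' = n - (i + 1) * (i' + 1) ∧ Delta2H n i i' ≤ 0 := by
  obtain ⟨h0, h0', h1, h2, h3⟩ := h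
  suffices hs : Delta2H n i i' = n - (i + 1) * (i' + 1) from ⟨hs, by rw [hs]; linarith⟩
  have e00 : Hgen n i i' = n := by
    unfold Hgen
    rw [if_pos ⟨h0, h0'⟩]
    exact min_eq_left h1
  have e10 := Hgen_of_le n (i - 1) i' (by omega) (by omega) (by linarith)
  have e01 := Hgen_of_le n i (i' - 1) (by omega) (by omega) (by linarith)
  have e11 := Hgen_of_le n (i - 1) (i' - 1) (by omega) (by omega) (by nlinarith)
  simp only [Delta2H, Finset.sum_range_succ, Finset.sum_range_zero, Nat.choose]
  norm_num
  rw [e00, e10, e01, e11]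
  rcases eq_or_lt_of_le h0 with hi | hi
  · subst hi
    have hi' : 1 ≤ i' := by omega
    have e02 := Hgen_of_le n 0 (i' - 2) (by omega) (by omega) (by linarith)
    rw [e02, Hgen_of_neg n (0 - 1) (i' - 2) (by omega), Hgen_of_neg n (0 - 2) i' (by omega),
      Hgen_of_neg n (0 - 2) (i' - 1) (by omega), Hgen_of_neg n (0 - 2) (i' - 2) (by omega)]
    ring
  · have e20 := Hgen_of_le n (i - 2) i' (by omega) (by omega) (by nlinarith)
    have e21 := Hgen_of_le n (i - 2) (i' - 1) (by omega) (by omega) (by nlinarith)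
    rw [e20, e21]
    rcases eq_or_lt_of_le h0' with hi' | hi'
    · subst hi'
      rw [Hgen_of_neg n i (0 - 2) (by omega), Hgen_of_neg n (i - 1) (0 - 2) (by omega),
        Hgen_of_neg n (i - 2) (0 - 2) (by omega)]
      ring
    · have e02 := Hgen_of_le n i (i' - 2) (by omega) (by omega) (by nlinarith)
      have e12 := Hgen_of_le n (i - 1) (i' - 2) (by omega) (by omega) (by nlinarith)
      have e22 := Hgen_of_le n (i - 2) (i' - 2) (by omega) (by omega) (by nlinarith)
      rw [e02, e12, e22]
      ring
end

section
/- Let n ≥ 2 be an integer and let (i,i') be a minimal regularity element for n. If i(i'+2) ≤ n, then Δ²H_n(i, i'+1) = (i+1)i' − n < 0; and if (i+2)i' ≤ n, then Δ²H_n(i+1, i') = i(i'+1) − n < 0. -/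
theorem Hgen_neg {n i j : ℤ} (h : i < 0) : Hgen n i j = 0 := by
  unfold Hgen
  rw [if_neg (by omega)]

theorem Hgen_symm (n i j : ℤ) : Hgen n i j = Hgen n j i := by
  unfold Hgen
  rw [mul_comm (i + 1)]
  split_ifs <;> first | rfl | omega

theorem Hgen_full {n i j : ℤ} (hi : 0 ≤ i) (hj : 0 ≤ j) (h : n ≤ (i + 1) * (j + 1)) :
    Hgen n i j = n := by
  unfold Hgen
  rw [if_pos ⟨hi, hj⟩, min_eq_left h]

theorem Hgen_prod {n i j : ℤ} (hi : -1 ≤ i) (hj : -1 ≤ j) (h : (i + 1) * (j + 1) ≤ n) :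
    Hgen n i j = (i + 1) * (j + 1) := by
  unfold Hgen
  split_ifs with hc
  · exact min_eq_right h
  · have : i = -1 ∨ j = -1 := by omega
    rcases this with rfl | rfl <;> simp

theorem Delta2H_expand (n i j : ℤ) : Delta2H n i j =
    (Hgen n i j - 2 * Hgen n i (j - 1) + Hgen n i (j - 2))
    - 2 * (Hgen n (i - 1) j - 2 * Hgen n (i - 1) (j - 1) + Hgen n (i - 1) (j - 2))
    + (Hgen n (i - 2) j - 2 * Hgen n (i - 2) (j - 1) + Hgen n (i - 2) (j - 2)) := by
  unfold Delta2H
  simp [Finset.sum_range_succ]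
  ring

theorem Delta2H_symm (n i j : ℤ) : Delta2H n i j = Delta2H n j i := by
  rw [Delta2H_expand, Delta2H_expand]
  simp only [Hgen_symm n j, Hgen_symm n (j - 1), Hgen_symm n (j - 2)]
  ring

/-- The rows below the top one are linear, so only the top row contributes. -/
theorem Delta2H_main (n i j : ℤ) (h : MinRegElem n i j) (hle : i * (j + 2) ≤ n) :
    Delta2H n i (j + 1) = (i + 1) * j - n := by
  obtain ⟨hi, hj, h1, h2, h3⟩ := h
  rw [Delta2H_expand, show j + 1 - 1 = j by ring, show j + 1 - 2 = j - 1 by ring]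
  rw [Hgen_full hi (by omega : 0 ≤ j + 1) (by nlinarith), Hgen_full hi hj h1,
    Hgen_prod (by omega : -1 ≤ i) (by omega : -1 ≤ j - 1) (by nlinarith),
    Hgen_prod (by omega : -1 ≤ i - 1) (by omega : -1 ≤ j + 1) (by nlinarith),
    Hgen_prod (by omega : -1 ≤ i - 1) (by omega : -1 ≤ j) (by nlinarith),
    Hgen_prod (by omega : -1 ≤ i - 1) (by omega : -1 ≤ j - 1) (by nlinarith)]
  by_cases h0 : i = 0
  · subst h0
    rw [Hgen_neg (by omega), Hgen_neg (by omega), Hgen_neg (by omega)]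
    ring
  · rw [Hgen_prod (by omega : -1 ≤ i - 2) (by omega : -1 ≤ j + 1) (by nlinarith),
      Hgen_prod (by omega : -1 ≤ i - 2) (by omega : -1 ≤ j) (by nlinarith),
      Hgen_prod (by omega : -1 ≤ i - 2) (by omega : -1 ≤ j - 1) (by nlinarith)]
    ring

theorem stmt_3 (n i i' : ℤ) (hn : 2 ≤ n) (h : MinRegElem n i i') :
    (i * (i' + 2) ≤ n →
      Delta2H n i (i' + 1) = (i + 1) * i' - n ∧ (i + 1) * i' - n < 0) ∧
    ((i + 2) * i' ≤ n →
      Delta2H n (i + 1) i' = i * (i' + 1) - n ∧ i * (i' + 1) - n < 0) := by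
  have h' := h
  obtain ⟨hi, hj, h1, h2, h3⟩ := h'
  refine ⟨fun hle => ⟨Delta2H_main n i i' h hle, by linarith⟩, fun hle => ⟨?_, by linarith⟩⟩
  have hs : MinRegElem n i' i :=
    ⟨hj, hi, by linarith [mul_comm (i + 1) (i' + 1)], by linarith, by linarith⟩
  rw [Delta2H_symm, Delta2H_main n i' i hs (by linarith)]
  ring
end

section
/- Let n ≥ 2 be an integer and let (i,i') be a minimal regularity element for n such that i(i'+2) ≤ n and (i+2)i' ≤ n. Then Δ²H_n(i+1, i'+1) = n − ii', and this quantity is strictly positive. -/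
theorem Hgen_low (n x y p q : ℤ) (hx : x + 1 = p) (hy : y + 1 = q) (hp : 0 ≤ p) (hq : 0 ≤ q)
    (h : p * q ≤ n) : Hgen n x y = p * q := by
  subst hx hy
  unfold Hgen
  split_ifs with hc
  · exact min_eq_right h
  · have : x + 1 = 0 ∨ y + 1 = 0 := by omega
    rcases this with h0 | h0 <;> simp [h0]

theorem Hgen_high (n x y : ℤ) (hx : 0 ≤ x) (hy : 0 ≤ y)
    (h : n ≤ (x + 1) * (y + 1)) : Hgen n x y = n := by
  unfold Hgen
  rw [if_pos ⟨hx, hy⟩, min_eq_left h]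

theorem stmt_4 (n i i' : ℤ) (hn : 2 ≤ n) (h : MinRegElem n i i')
    (h1 : i * (i' + 2) ≤ n) (h2 : (i + 2) * i' ≤ n) :
    Delta2H n (i + 1) (i' + 1) = n - i * i' ∧ 0 < n - i * i' := by
  obtain ⟨hi, hj, h3, h4, h5⟩ := h
  have hpos : 0 < n - i * i' := by nlinarith
  refine ⟨?_, hpos⟩
  have e00 := Hgen_high n (i + 1 - 0) (i' + 1 - 0) (by omega) (by omega) (by nlinarith)
  have e01 := Hgen_high n (i + 1 - 0) (i' + 1 - 1) (by omega) (by omega) (by nlinarith)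
  have e10 := Hgen_high n (i + 1 - 1) (i' + 1 - 0) (by omega) (by omega) (by nlinarith)
  have e11 := Hgen_high n (i + 1 - 1) (i' + 1 - 1) (by omega) (by omega) (by nlinarith)
  have e02 := Hgen_low n (i + 1 - 0) (i' + 1 - 2) (i + 2) i' (by ring) (by ring) (by omega) hj h2
  have e12 := Hgen_low n (i + 1 - 1) (i' + 1 - 2) (i + 1) i' (by ring) (by ring) (by omega) hj h5.le
  have e22 := Hgen_low n (i + 1 - 2) (i' + 1 - 2) i i' (by ring) (by ring) hi hj (by omega)
  have e20 := Hgen_low n (i + 1 - 2) (i' + 1 - 0) i (i' + 2) (by ring) (by ring) hi (by omega) h1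
  have e21 := Hgen_low n (i + 1 - 2) (i' + 1 - 1) i (i' + 1) (by ring) (by ring) hi (by omega) h4.le
  simp only [Delta2H, Finset.sum_range_succ, Finset.sum_range_zero, Nat.cast_zero, Nat.cast_one,
    Nat.cast_ofNat, e00, e01, e10, e11, e02, e12, e22, e20, e21]
  norm_num [Nat.choose]
  ring
end

section
/- Let n ≥ 2 be an integer and let (i,i') be a minimal regularity element for n such that i(i'+2) ≤ n and (i+2)i' > n. Then Δ²H_n(i+1, i'+1) = 2(n − ii' − i'), and this quantity is strictly positive. -/
theorem Hgen_eq_min (n a b : ℤ) (hn : 0 ≤ n) (ha : -1 ≤ a) (hb : -1 ≤ b) :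
    Hgen n a b = min n ((a + 1) * (b + 1)) := by
  unfold Hgen
  split_ifs with h
  · rfl
  · have h0 : (a + 1) * (b + 1) = 0 := by
      rcases (show a = -1 ∨ b = -1 by omega) with h | h <;> simp [h]
    rw [h0, min_eq_right hn]

theorem Hgen_eq_n (n a b : ℤ) (hn : 0 ≤ n) (ha : -1 ≤ a) (hb : -1 ≤ b)
    (h : n ≤ (a + 1) * (b + 1)) : Hgen n a b = n := by
  rw [Hgen_eq_min n a b hn ha hb, min_eq_left h]

theorem Hgen_eq_mul (n a b : ℤ) (hn : 0 ≤ n) (ha : -1 ≤ a) (hb : -1 ≤ b)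
    (h : (a + 1) * (b + 1) ≤ n) : Hgen n a b = (a + 1) * (b + 1) := by
  rw [Hgen_eq_min n a b hn ha hb, min_eq_right h]

theorem stmt_5 (n i i' : ℤ) (hn : 2 ≤ n) (h : MinRegElem n i i')
    (h1 : i * (i' + 2) ≤ n) (h2 : (i + 2) * i' > n) :
    Delta2H n (i + 1) (i' + 1) = 2 * (n - i * i' - i') ∧ 0 < 2 * (n - i * i' - i') := by
  obtain ⟨hi, hi', hr, ha, hb⟩ := h
  have hn0 : 0 ≤ n := by omega
  refine ⟨?_, by nlinarith⟩
  have e00 := Hgen_eq_n n (i + 1 - 0) (i' + 1 - 0) hn0 (by omega) (by omega) (by nlinarith)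
  have e01 := Hgen_eq_n n (i + 1 - 0) (i' + 1 - 1) hn0 (by omega) (by omega) (by nlinarith)
  have e02 := Hgen_eq_n n (i + 1 - 0) (i' + 1 - 2) hn0 (by omega) (by omega) (by nlinarith)
  have e10 := Hgen_eq_n n (i + 1 - 1) (i' + 1 - 0) hn0 (by omega) (by omega) (by nlinarith)
  have e11 := Hgen_eq_n n (i + 1 - 1) (i' + 1 - 1) hn0 (by omega) (by omega) (by nlinarith)
  have e12 := Hgen_eq_mul n (i + 1 - 1) (i' + 1 - 2) hn0 (by omega) (by omega) (by nlinarith)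
  have e20 := Hgen_eq_mul n (i + 1 - 2) (i' + 1 - 0) hn0 (by omega) (by omega) (by nlinarith)
  have e21 := Hgen_eq_mul n (i + 1 - 2) (i' + 1 - 1) hn0 (by omega) (by omega) (by nlinarith)
  have e22 := Hgen_eq_mul n (i + 1 - 2) (i' + 1 - 2) hn0 (by omega) (by omega) (by nlinarith)
  unfold Delta2H
  simp only [Finset.sum_range_succ, Finset.sum_range_zero, Nat.cast_zero, Nat.cast_one,
    Nat.cast_ofNat, e00, e01, e02, e10, e11, e12, e20, e21, e22]
  norm_num [Nat.choose]
  ring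
end

section
/- Let n ≥ 2 be an integer and let (i,i') be a minimal regularity element for n with i ≤ i' and i(i'+2) > n. Then (i+2)i' > n and Δ²H_n(i+1, i'+1) = 3n − 3ii' − 2i − 2i'. -/
theorem stmt_6 (n i i' : ℤ) (hn : 2 ≤ n) (h : MinRegElem n i i')
    (hii' : i ≤ i') (h1 : i * (i' + 2) > n) :
    (i + 2) * i' > n ∧
      Delta2H n (i + 1) (i' + 1) = 3 * n - 3 * i * i' - 2 * i - 2 * i' := by
  obtain ⟨hi, hi', hge, hlt1, hlt2⟩ := h
  have h2 : (i + 2) * i' > n := by nlinarith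
  refine ⟨h2, ?_⟩
  have hi1 : 1 ≤ i := by
    by_contra hc
    have : i = 0 := by omega
    subst this
    simp at h1
    omega
  have hbig : ∀ a b : ℤ, 0 ≤ a → 0 ≤ b → n ≤ (a + 1) * (b + 1) → Hgen n a b = n := by
    intro a b ha hb hab
    simp [Hgen, ha, hb, hab]
  have hsmall : ∀ a b : ℤ, 0 ≤ a → 0 ≤ b → (a + 1) * (b + 1) ≤ n →
      Hgen n a b = (a + 1) * (b + 1) := by
    intro a b ha hb hab
    simp [Hgen, ha, hb, hab]
  have e00 := hbig (i + 1) (i' + 1) (by omega) (by omega) (by nlinarith)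
  have e01 := hbig (i + 1) i' (by omega) (by omega) (by nlinarith)
  have e02 := hbig (i + 1) (i' - 1) (by omega) (by omega) (by nlinarith)
  have e10 := hbig i (i' + 1) (by omega) (by omega) (by nlinarith)
  have e11 := hbig i i' (by omega) (by omega) (by nlinarith)
  have e12 := hsmall i (i' - 1) (by omega) (by omega) (by nlinarith)
  have e20 := hbig (i - 1) (i' + 1) (by omega) (by omega) (by nlinarith)
  have e21 := hsmall (i - 1) i' (by omega) (by omega) (by nlinarith)
  have e22 := hsmall (i - 1) (i' - 1) (by omega) (by omega) (by nlinarith)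
  have t0 : ∀ x : ℤ, x + 1 - ((0 : ℕ) : ℤ) = x + 1 := by intro x; simp
  have t1 : ∀ x : ℤ, x + 1 - ((1 : ℕ) : ℤ) = x := by intro x; simp
  have t2 : ∀ x : ℤ, x + 1 - ((2 : ℕ) : ℤ) = x - 1 := by intro x; push_cast; ring
  have c0 : Nat.choose 2 0 = 1 := rfl
  have c1 : Nat.choose 2 1 = 2 := rfl
  have c2 : Nat.choose 2 2 = 1 := rfl
  simp only [Delta2H, Finset.sum_range_succ, Finset.sum_range_zero, t0, t1, t2,
    c0, c1, c2, e00, e01, e02, e10, e11, e12, e20, e21, e22]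
  push_cast
  ring
end

section
/- Let n ≥ 2 be an integer and let (i,i') be a minimal regularity element for n with i ≤ i' and i(i'+2) > n. Then i ≥ 2, (i−1)(i'+2) < n, and the pair (i−1, i'+1) is itself a minimal regularity element for n. -/
theorem stmt_9 (n i i' : ℤ) (hn : 2 ≤ n) (h : MinRegElem n i i')
    (hii' : i ≤ i') (h1 : i * (i' + 2) > n) :
    2 ≤ i ∧ (i - 1) * (i' + 2) < n ∧ MinRegElem n (i - 1) (i' + 1) := by
  obtain ⟨hi, hi', ha, hb, hc⟩ := h
  have h2 : 2 ≤ i := by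
    by_contra hlt
    have : i = 0 ∨ i = 1 := by omega
    rcases this with rfl | rfl <;> omega
  have h3 : (i - 1) * (i' + 2) < n := by nlinarith
  refine ⟨h2, h3, by omega, by omega, ?_, ?_, ?_⟩ <;> nlinarith
end

section
/- Let n ≥ 2 be an integer and let (i,i') be a minimal regularity element for n with i ≤ i', i(i'+2) > n, 3n − 3ii' − 2i − 2i' ≥ 0, and −3n + 3ii' + 4i + i' ≤ 0. Then Δ²H_n(i+1, i'+1) = 3n − 3ii' − 2i − 2i' and this quantity is strictly positive. -/
theorem stmt_12 (n i i' : ℤ) (hn : 2 ≤ n) (h : MinRegElem n i i')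
    (hii' : i ≤ i') (h1 : i * (i' + 2) > n)
    (h2 : 3 * n - 3 * i * i' - 2 * i - 2 * i' ≥ 0)
    (h3 : -3 * n + 3 * i * i' + 4 * i + i' ≤ 0) :
    Delta2H n (i + 1) (i' + 1) = 3 * n - 3 * i * i' - 2 * i - 2 * i' ∧
      0 < 3 * n - 3 * i * i' - 2 * i - 2 * i' := by
  obtain ⟨hi, hi', ha, hb, hc⟩ := h
  have hi1 : 1 ≤ i := by
    by_contra hlt
    have h0 : i = 0 := by omega
    subst h0
    omega
  have e1 : Hgen n (i + 1) (i' + 1) = n := by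
    unfold Hgen
    rw [if_pos ⟨by omega, by omega⟩, min_eq_left (by nlinarith)]
  have e2 : Hgen n (i + 1) i' = n := by
    unfold Hgen
    rw [if_pos ⟨by omega, by omega⟩, min_eq_left (by nlinarith)]
  have e3 : Hgen n (i + 1) (i' - 1) = n := by
    unfold Hgen
    rw [if_pos ⟨by omega, by omega⟩, min_eq_left (by nlinarith)]
  have e4 : Hgen n i (i' + 1) = n := by
    unfold Hgen
    rw [if_pos ⟨by omega, by omega⟩, min_eq_left (by nlinarith)]
  have e5 : Hgen n i i' = n := by
    unfold Hgen
    rw [if_pos ⟨by omega, by omega⟩, min_eq_left (by nlinarith)]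
  have e6 : Hgen n i (i' - 1) = (i + 1) * i' := by
    unfold Hgen
    rw [if_pos ⟨by omega, by omega⟩, min_eq_right (by nlinarith)]
    ring
  have e7 : Hgen n (i - 1) (i' + 1) = n := by
    unfold Hgen
    rw [if_pos ⟨by omega, by omega⟩, min_eq_left (by nlinarith)]
  have e8 : Hgen n (i - 1) i' = i * (i' + 1) := by
    unfold Hgen
    rw [if_pos ⟨by omega, by omega⟩, min_eq_right (by nlinarith)]
    ring
  have e9 : Hgen n (i - 1) (i' - 1) = i * i' := by
    unfold Hgen
    rw [if_pos ⟨by omega, by omega⟩, min_eq_right (by nlinarith)]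
    ring
  constructor
  · have s0 : ∀ x : ℤ, x + 1 - ((0 : ℕ) : ℤ) = x + 1 := by intro x; simp
    have s1 : ∀ x : ℤ, x + 1 - ((1 : ℕ) : ℤ) = x := by intro x; simp
    have s2 : ∀ x : ℤ, x + 1 - ((2 : ℕ) : ℤ) = x - 1 := by
      intro x; push_cast; ring
    unfold Delta2H
    simp only [Finset.sum_range_succ, Finset.sum_range_zero, s0, s1, s2,
      e1, e2, e3, e4, e5, e6, e7, e8, e9]
    norm_num [Nat.choose]
    ring
  · nlinarith
end

section
/- Let n ≥ 2 be an integer and let (i,i') be a minimal regularity element for n with i' ≥ 1, (i+2)(i'−1) < n, and (i+2)i' ≥ n. Then Δ²H_n(i+1, i'−1) = n − ii' − 2i' ≤ 0 and Δ²H_n(i+1, i') = −3n + 3ii' + i + 4i'. -/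
theorem Hgen_prod_s13 (n a b p q : ℤ) (hn : 0 ≤ n) (hp : a + 1 = p) (hq : b + 1 = q)
    (hp0 : 0 ≤ p) (hq0 : 0 ≤ q) (hle : p * q ≤ n) : Hgen n a b = p * q := by
  subst hp hq
  unfold Hgen
  split_ifs with h
  · exact min_eq_right hle
  · have : a + 1 = 0 ∨ b + 1 = 0 := by omega
    rcases this with h | h <;> simp [h]

theorem Hgen_n (n a b p q : ℤ) (hp : a + 1 = p) (hq : b + 1 = q)
    (hp0 : 1 ≤ p) (hq0 : 1 ≤ q) (hle : n ≤ p * q) : Hgen n a b = n := by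
  subst hp hq
  unfold Hgen
  rw [if_pos (by omega)]
  exact min_eq_left hle

theorem Hgen_neg_s13 (n a b : ℤ) (hb : b < 0) : Hgen n a b = 0 := by
  unfold Hgen
  rw [if_neg (by omega)]

theorem stmt_13 (n i i' : ℤ) (hn : 2 ≤ n) (h : MinRegElem n i i')
    (hi' : 1 ≤ i') (h1 : (i + 2) * (i' - 1) < n) (h2 : (i + 2) * i' ≥ n) :
    Delta2H n (i + 1) (i' - 1) = n - i * i' - 2 * i' ∧
      n - i * i' - 2 * i' ≤ 0 ∧
      Delta2H n (i + 1) i' = -3 * n + 3 * i * i' + i + 4 * i' := by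
  obtain ⟨h0, h0', g1, g2, g3⟩ := h
  have e1 : Hgen n (i + 1) i' = n :=
    Hgen_n n _ _ (i + 2) (i' + 1) (by ring) (by ring) (by omega) (by omega) (by nlinarith)
  have e2 : Hgen n i i' = n :=
    Hgen_n n _ _ (i + 1) (i' + 1) (by ring) (by ring) (by omega) (by omega) (by nlinarith)
  have e3 : Hgen n (i - 1) i' = i * (i' + 1) :=
    Hgen_prod_s13 n _ _ _ _ (by omega) (by ring) (by ring) (by omega) (by omega) (by nlinarith)
  have e4 : Hgen n (i + 1) (i' - 1) = n :=
    Hgen_n n _ _ (i + 2) i' (by ring) (by ring) (by omega) (by omega) (by nlinarith)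
  have e5 : Hgen n i (i' - 1) = (i + 1) * i' :=
    Hgen_prod_s13 n _ _ _ _ (by omega) (by ring) (by ring) (by omega) (by omega) (by nlinarith)
  have e6 : Hgen n (i - 1) (i' - 1) = i * i' :=
    Hgen_prod_s13 n _ _ _ _ (by omega) (by ring) (by ring) (by omega) (by omega) (by nlinarith)
  have e7 : Hgen n (i + 1) (i' - 2) = (i + 2) * (i' - 1) :=
    Hgen_prod_s13 n _ _ _ _ (by omega) (by ring) (by ring) (by omega) (by omega) (by nlinarith)
  have e8 : Hgen n i (i' - 2) = (i + 1) * (i' - 1) :=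
    Hgen_prod_s13 n _ _ _ _ (by omega) (by ring) (by ring) (by omega) (by omega) (by nlinarith)
  have e9 : Hgen n (i - 1) (i' - 2) = i * (i' - 1) :=
    Hgen_prod_s13 n _ _ _ _ (by omega) (by ring) (by ring) (by omega) (by omega) (by nlinarith)
  have e10 : Hgen n (i + 1) (i' - 3) - 2 * Hgen n i (i' - 3) + Hgen n (i - 1) (i' - 3) = 0 := by
    by_cases hc : i' = 1
    · rw [Hgen_neg_s13 n _ _ (by omega), Hgen_neg_s13 n _ _ (by omega), Hgen_neg_s13 n _ _ (by omega)]
      norm_num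
    · rw [Hgen_prod_s13 n (i + 1) (i' - 3) (i + 2) (i' - 2) (by omega) (by ring) (by ring)
          (by omega) (by omega) (by nlinarith),
        Hgen_prod_s13 n i (i' - 3) (i + 1) (i' - 2) (by omega) (by ring) (by ring)
          (by omega) (by omega) (by nlinarith),
        Hgen_prod_s13 n (i - 1) (i' - 3) i (i' - 2) (by omega) (by ring) (by ring)
          (by omega) (by omega) (by nlinarith)]
      ring
  have s1 : i + 1 - 1 = i := by ring
  have s2 : i + 1 - 2 = i - 1 := by ring
  have s3 : i' - 1 - 1 = i' - 2 := by ring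
  have s4 : i' - 1 - 2 = i' - 3 := by ring
  have c2 : Nat.choose 2 1 = 2 := rfl
  refine ⟨?_, by nlinarith, ?_⟩
  · simp only [Delta2H, Finset.sum_range_succ, Finset.sum_range_zero, Nat.choose_zero_right,
      Nat.choose_self, c2, Nat.cast_zero, Nat.cast_one, Nat.cast_ofNat, sub_zero, s1, s2, s3, s4,
      e4, e5, e6, e7, e8, e9]
    linear_combination e10
  · simp only [Delta2H, Finset.sum_range_succ, Finset.sum_range_zero, Nat.choose_zero_right,
      Nat.choose_self, c2, Nat.cast_zero, Nat.cast_one, Nat.cast_ofNat, sub_zero, s1, s2,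
      e1, e2, e3, e4, e5, e6, e7, e8, e9]
    ring
end

section
/- Let n ≥ 2 be an integer and let (i,i') be a minimal regularity element for n with i' ≥ 1 and (i+2)(i'−1) ≥ n. Then Δ²H_n(i+1, i') = 2((i+1)(i'+1) − n), and this quantity is nonnegative. -/
theorem stmt_14 (n i i' : ℤ) (hn : 2 ≤ n) (h : MinRegElem n i i')
    (hi' : 1 ≤ i') (h1 : (i + 2) * (i' - 1) ≥ n) :
    Delta2H n (i + 1) i' = 2 * ((i + 1) * (i' + 1) - n) ∧
      0 ≤ 2 * ((i + 1) * (i' + 1) - n) := by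
  obtain ⟨h0, h0', ha, hb, hc⟩ := h
  refine ⟨?_, by linarith⟩
  have h2 : 2 ≤ i' := by
    by_contra hlt
    have : i' = 1 := by omega
    subst this
    simp at h1
    omega
  have A0 : Hgen n (i + 1) i' = n := by
    unfold Hgen
    rw [if_pos ⟨by omega, by omega⟩, min_eq_left (by nlinarith)]
  have A1 : Hgen n (i + 1) (i' - 1) = n := by
    unfold Hgen
    rw [if_pos ⟨by omega, by omega⟩, min_eq_left (by nlinarith)]
  have A2 : Hgen n (i + 1) (i' - 2) = n := by
    unfold Hgen
    rw [if_pos ⟨by omega, by omega⟩, min_eq_left (by nlinarith)]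
  have B0 : Hgen n i i' = n := by
    unfold Hgen
    rw [if_pos ⟨by omega, by omega⟩, min_eq_left (by nlinarith)]
  have B1 : Hgen n i (i' - 1) = (i + 1) * i' := by
    unfold Hgen
    rw [if_pos ⟨by omega, by omega⟩, min_eq_right (by nlinarith)]
    ring
  have B2 : Hgen n i (i' - 2) = (i + 1) * (i' - 1) := by
    unfold Hgen
    rw [if_pos ⟨by omega, by omega⟩, min_eq_right (by nlinarith)]
    ring
  have C : ∀ j, 0 ≤ j → j ≤ i' → Hgen n (i - 1) j = i * (j + 1) := by
    intro j hj hj'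
    unfold Hgen
    split_ifs with hh
    · rw [min_eq_right (by nlinarith)]
      ring
    · have : i = 0 := by omega
      simp [this]
  have C0 := C i' (by omega) (by omega)
  have C1 := C (i' - 1) (by omega) (by omega)
  have C2 := C (i' - 2) (by omega) (by omega)
  have e1 : i + 1 - 1 = i := by ring
  have e2 : i + 1 - 2 = i - 1 := by ring
  simp only [Delta2H, Finset.sum_range_succ, Finset.sum_range_zero, Nat.cast_zero, Nat.cast_one,
    Nat.cast_ofNat, sub_zero, e1, e2, A0, A1, A2, B0, B1, B2, C0, C1, C2]
  norm_num [Nat.choose]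
  ring
end

section
/- Let n ≥ 2 be an integer and let (r,r') be a pair of nonnegative integers with (r,r') ≠ (0,0). If (r+1)(r'+1) ≤ n, then Δ²H_n(r, r') = 0. Moreover, for any pair (r,r') of nonnegative integers with (r−1)(r'−1) ≥ n, one also has Δ²H_n(r, r') = 0. -/
theorem Hgen_low_s16 (n r r' i j : ℤ) (h : (r + 1) * (r' + 1) ≤ n) (hr : 0 ≤ r) (hr' : 0 ≤ r')
    (hi : i ≤ r) (hj : j ≤ r') : Hgen n i j = max (i + 1) 0 * max (j + 1) 0 := by
  unfold Hgen
  split_ifs with hc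
  · rw [max_eq_left (by omega), max_eq_left (by omega), min_eq_right]
    exact le_trans (mul_le_mul (by omega) (by omega) (by omega) (by omega)) h
  · by_cases h0 : 0 ≤ i
    · rw [max_eq_right (a := j + 1) (by omega), mul_zero]
    · rw [max_eq_right (a := i + 1) (by omega), zero_mul]

theorem Hgen_high_s16 (n s s' i j : ℤ) (h : n ≤ s * s') (hs : 0 < s) (hs' : 0 < s')
    (hi : s ≤ i + 1) (hj : s' ≤ j + 1) : Hgen n i j = n := by
  unfold Hgen
  rw [if_pos (by omega), min_eq_left]
  exact le_trans h (mul_le_mul hi hj (by omega) (by omega))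

theorem second_diff (r : ℤ) (h : 0 < r) :
    max (r + 1) 0 - 2 * max (r - 1 + 1) 0 + max (r - 2 + 1) 0 = 0 := by
  omega

theorem stmt_16 (n : ℤ) (hn : 2 ≤ n) (r r' : ℤ) (hr : 0 ≤ r) (hr' : 0 ≤ r') :
    ((r, r') ≠ (0, 0) → (r + 1) * (r' + 1) ≤ n → Delta2H n r r' = 0) ∧
    ((r - 1) * (r' - 1) ≥ n → Delta2H n r r' = 0) := by
  constructor
  · intro hne h
    have key : Delta2H n r r' =
        (max (r + 1) 0 - 2 * max (r - 1 + 1) 0 + max (r - 2 + 1) 0) *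
        (max (r' + 1) 0 - 2 * max (r' - 1 + 1) 0 + max (r' - 2 + 1) 0) := by
      have e : ∀ a b : ℕ, Hgen n (r - a) (r' - b) =
          max (r - a + 1) 0 * max (r' - b + 1) 0 := fun a b =>
        Hgen_low_s16 n r r' _ _ h hr hr' (by omega) (by omega)
      simp only [Delta2H, e]
      simp only [Finset.sum_range_succ, Finset.sum_range_zero, Nat.choose_zero_right,
        Nat.choose_one_right, Nat.choose_self, Nat.cast_zero, Nat.cast_one, Nat.cast_ofNat,
        sub_zero]
      ring
    rw [key]
    by_cases h0 : r = 0
    · have : 0 < r' := by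
        rcases hr'.lt_or_eq with h1 | h1
        · exact h1
        · exact absurd (by rw [h0, ← h1]) hne
      rw [second_diff r' this, mul_zero]
    · rw [second_diff r (by omega), zero_mul]
  · intro h
    have hpos : 0 < r - 1 ∧ 0 < r' - 1 := by
      constructor
      · by_contra hc
        have : r = 0 ∨ r = 1 := by omega
        rcases this with rfl | rfl <;> omega
      · by_contra hc
        have : r' = 0 ∨ r' = 1 := by omega
        rcases this with rfl | rfl <;> omega
    have e : ∀ a ∈ Finset.range 3, ∀ b ∈ Finset.range 3,
        Hgen n (r - (a : ℕ)) (r' - (b : ℕ)) = n := by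
      intro a ha b hb
      rw [Finset.mem_range] at ha hb
      exact Hgen_high_s16 n _ _ _ _ h hpos.1 hpos.2 (by omega) (by omega)
    have : Delta2H n r r' = ∑ a ∈ Finset.range 3, ∑ b ∈ Finset.range 3,
        (-1 : ℤ) ^ (a + b) * (Nat.choose 2 a : ℤ) * (Nat.choose 2 b : ℤ) * n :=
      Finset.sum_congr rfl fun a ha => Finset.sum_congr rfl fun b hb => by rw [e a ha b hb]
    rw [this]
    simp only [Finset.sum_range_succ, Finset.sum_range_zero, Nat.choose_zero_right,
        Nat.choose_one_right, Nat.choose_self, Nat.cast_one, Nat.cast_ofNat]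
    ring
end
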